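/- arXiv:2003.05180 — 2 statements merged into one kernel-verified Lean document; each statement's English description precedes it below -/
import Mathlib

section
/- Let a_1, …, a_n be an admissible sequence for T_α with continuants q_0, q_1, …, q_n. If α ∈ [1/2, g], then |q_n| > |q_{n−1}|. If α ∈ (g, 1], then −1/2 < q_{n−1}/q_n < 2, and q_{n−1}/q_n ≥ 1 can hold only if a_n = 1. -/
open MeasureTheory Set

noncomputable def g : ℝ := (Real.sqrt 5 - 1) / 2

noncomputable def T (α : ℝ) (x : ℝ) : ℝ :=
  if x = 0 then 0 else 1 / x - ⌊1 / x + 1 - α⌋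

noncomputable def digit (α : ℝ) (k : ℕ) (x : ℝ) : ℤ :=
  if (T α)^[k - 1] x = 0 then 0 else ⌊1 / ((T α)^[k - 1] x) + 1 - α⌋

noncomputable def cylinder (α : ℝ) (n : ℕ) (a : ℕ → ℤ) : Set ℝ :=
  {x | x ∈ Set.Ico (α - 1) α ∧ ∀ k, 1 ≤ k → k ≤ n → digit α k x = a k}

def contQ (a : ℕ → ℤ) : ℕ → ℤ
  | 0 => 1
  | 1 => a 1
  | (n + 2) => a (n + 2) * contQ a (n + 1) + contQ a n

def contP (a : ℕ → ℤ) : ℕ → ℤ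
  | 0 => 0
  | 1 => 1
  | (n + 2) => a (n + 2) * contP a (n + 1) + contP a n

noncomputable def NT (α : ℝ) (p : ℝ × ℝ) : ℝ × ℝ :=
  if p.1 = 0 then (0, 0)
  else (1 / p.1 - ⌊1 / p.1 + 1 - α⌋, 1 / (p.2 + ⌊1 / p.1 + 1 - α⌋))

noncomputable def Omega (α : ℝ) : Set (ℝ × ℝ) :=
  ⋃ n : ℕ, closure ((NT α)^[n] '' (Set.Ico (α - 1) α ×ˢ ({0} : Set ℝ)))

def Sset (x y : ℝ) : Set (ℝ × ℝ) :=
  {(x, y), (-x, -y), (x + 1, y / (1 - y)), (1 - x, -y / (y + 1))}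

noncomputable def jumpTime (α : ℝ) (x : ℝ) : ℕ :=
  sInf {n : ℕ | 1 ≤ n ∧
    (T α)^[n] '' cylinder α n (fun k => digit α k x) = Set.Ico (α - 1) α}

noncomputable def jumpT (α : ℝ) (x : ℝ) : ℝ := (T α)^[jumpTime α x] x

theorem T_mem_Ico {α x : ℝ} (hα : α ∈ Set.Icc (1 / 2 : ℝ) 1) : T α x ∈ Set.Ico (α - 1) α := by
  obtain ⟨h1, h2⟩ := hα
  unfold T
  split_ifs
  · constructor <;> linarith
  · have h3 := Int.floor_le (1 / x + 1 - α)
    have h4 := Int.lt_floor_add_one (1 / x + 1 - α)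
    constructor <;> linarith

theorem iterate_T_mem_Ico {α x : ℝ} (hα : α ∈ Set.Icc (1 / 2 : ℝ) 1)
    (hx : x ∈ Set.Ico (α - 1) α) (k : ℕ) : (T α)^[k] x ∈ Set.Ico (α - 1) α := by
  cases k with
  | zero => simpa using hx
  | succ k =>
    rw [Function.iterate_succ_apply']
    exact T_mem_Ico hα

theorem g_sq : g ^ 2 + g = 1 := by
  unfold g
  have := Real.sq_sqrt (show (0 : ℝ) ≤ 5 by norm_num)
  nlinarith

theorem g_pos : 0 < g := by
  unfold g
  have : (1 : ℝ) < Real.sqrt 5 := Real.lt_sqrt_of_sq_lt (by norm_num)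
  linarith

theorem one_le_floor_of_pos {α y : ℝ} (hα : α ∈ Set.Icc (1 / 2 : ℝ) 1) (hy : y < α)
    (hy0 : 0 < y) : 1 ≤ ⌊1 / y + 1 - α⌋ := by
  obtain ⟨h1, h2⟩ := hα
  have : 1 ≤ 1 / y := by rw [le_div_iff₀ hy0]; linarith
  rw [Int.le_floor]
  push_cast
  linarith

theorem two_le_floor_of_pos {α y : ℝ} (hα : α ∈ Set.Icc (1 / 2 : ℝ) 1) (hg : α ≤ g)
    (hy : y < α) (hy0 : 0 < y) : 2 ≤ ⌊1 / y + 1 - α⌋ := by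
  obtain ⟨h1, h2⟩ := hα
  have : 1 + α ≤ 1 / y := by
    rw [le_div_iff₀ hy0]
    nlinarith [g_sq, g_pos]
  rw [Int.le_floor]
  push_cast
  linarith

theorem floor_le_neg_two_of_neg {α y : ℝ} (hα : α ∈ Set.Icc (1 / 2 : ℝ) 1)
    (hy : α - 1 ≤ y) (hy0 : y < 0) : ⌊1 / y + 1 - α⌋ ≤ -2 := by
  obtain ⟨h1, h2⟩ := hα
  have : 1 / y ≤ -2 := by
    rw [div_le_iff_of_neg hy0]
    linarith
  have h3 : ⌊1 / y + 1 - α⌋ < -1 := by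
    rw [Int.floor_lt]
    push_cast
    linarith
  omega

theorem floor_le_neg_three_of_neg {α y : ℝ} (hα : α ≤ 1) (hg : g < α)
    (hy : α - 1 ≤ y) (hy0 : y < 0) : ⌊1 / y + 1 - α⌋ ≤ -3 := by
  have : 1 / y < α - 3 := by
    have h6 : 3 / 5 < g := by nlinarith [g_sq, g_pos]
    have h7 : (α - 3) * y ≤ (3 - α) * (1 - α) := by
      nlinarith [mul_nonneg (show 0 ≤ 3 - α by linarith) (sub_nonneg.2 hy)]
    rw [div_lt_iff_of_neg hy0]
    nlinarith
  have h3 : ⌊1 / y + 1 - α⌋ < -2 := by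
    rw [Int.floor_lt]
    push_cast
    linarith
  omega

theorem inv_add_bounds {a : ℤ} {t : ℝ} (h1 : -(1 / 2) < t) (h2 : t < 2)
    (h : 1 ≤ a ∨ a ≤ -3 ∧ t < 1) :
    (a : ℝ) + t ≠ 0 ∧ -(1 / 2) < 1 / ((a : ℝ) + t) ∧ 1 / ((a : ℝ) + t) < 2 ∧
      (1 ≤ 1 / ((a : ℝ) + t) → a = 1) := by
  rcases h with h | ⟨h, ht⟩
  · have ha : (1 : ℝ) ≤ a := by exact_mod_cast h
    have hp : 0 < (a : ℝ) + t := by linarith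
    have hq : 0 < 1 / ((a : ℝ) + t) := by positivity
    refine ⟨hp.ne', by linarith, ?_, fun h3 => ?_⟩
    · rw [div_lt_iff₀ hp]; linarith
    · rw [le_div_iff₀ hp] at h3
      have h4 : (a : ℝ) < 2 := by linarith
      have h5 : a < 2 := by exact_mod_cast h4
      omega
  · have ha : (a : ℝ) ≤ -3 := by exact_mod_cast h
    have hp : (a : ℝ) + t < 0 := by linarith
    have hq : 1 / ((a : ℝ) + t) < 0 := one_div_neg.2 hp
    refine ⟨hp.ne, ?_, by linarith, fun h3 => by linarith⟩
    rw [lt_div_iff_of_neg hp]; linarith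

theorem abs_contQ_lt_succ {a : ℕ → ℤ} {n : ℕ} (h : ∀ k < n, 2 ≤ |a (k + 1)|) :
    ∀ k < n, |contQ a k| < |contQ a (k + 1)| := by
  intro k
  induction k with
  | zero =>
    intro hk
    have := h 0 hk
    simp only [contQ, zero_add] at this ⊢
    norm_num
    omega
  | succ k ih =>
    intro hk
    have h1 := ih (by omega)
    have h2 := h (k + 1) hk
    have h3 : |a (k + 2) * contQ a (k + 1)| ≤ |contQ a (k + 2)| + |contQ a k| := by
      have : a (k + 2) * contQ a (k + 1) = contQ a (k + 2) - contQ a k := by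
        simp only [contQ]; ring
      rw [this]
      exact abs_sub _ _
    rw [abs_mul] at h3
    have h4 : 2 * |contQ a (k + 1)| ≤ |a (k + 2)| * |contQ a (k + 1)| :=
      mul_le_mul_of_nonneg_right h2 (abs_nonneg _)
    show |contQ a (k + 1)| < |contQ a (k + 2)|
    linarith

theorem contQ_div_succ_bounds {a : ℕ → ℤ} {n : ℕ} (h : ∀ k < n, 1 ≤ a (k + 1) ∨ a (k + 1) ≤ -3)
    (h1 : ∀ k, k + 1 < n → a (k + 1) = 1 → 1 ≤ a (k + 2)) :
    ∀ k < n, contQ a (k + 1) ≠ 0 ∧ -(1 / 2) < (contQ a k : ℝ) / contQ a (k + 1) ∧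
      (contQ a k : ℝ) / contQ a (k + 1) < 2 ∧
      (1 ≤ (contQ a k : ℝ) / contQ a (k + 1) → a (k + 1) = 1) := by
  intro k
  induction k with
  | zero =>
    intro hk
    have h0 := h 0 hk
    have := inv_add_bounds (a := a 1) (t := 0) (by norm_num) (by norm_num)
      (h0.imp_right fun h => ⟨h, by norm_num⟩)
    simpa [contQ] using this
  | succ k ih =>
    intro hk
    obtain ⟨hq, hl, hu, hone⟩ := ih (by omega)
    have hcond : 1 ≤ a (k + 2) ∨
        a (k + 2) ≤ -3 ∧ (contQ a k : ℝ) / contQ a (k + 1) < 1 := by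
      rcases h (k + 1) hk with h2 | h2
      · exact Or.inl h2
      · rcases lt_or_ge ((contQ a k : ℝ) / contQ a (k + 1)) 1 with h3 | h3
        · exact Or.inr ⟨h2, h3⟩
        · exact Or.inl (h1 k hk (hone h3))
    obtain ⟨hne, hb⟩ := inv_add_bounds hl hu hcond
    have hq' : (contQ a (k + 1) : ℝ) ≠ 0 := by exact_mod_cast hq
    have hrec : (contQ a (k + 2) : ℝ) =
        contQ a (k + 1) * (a (k + 2) + (contQ a k : ℝ) / contQ a (k + 1)) := by
      simp only [contQ]
      push_cast
      field_simp
    have hdiv : (contQ a (k + 1) : ℝ) / contQ a (k + 2) =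
        1 / (a (k + 2) + (contQ a k : ℝ) / contQ a (k + 1)) := by
      rw [hrec, ← div_div, div_self hq']
    refine ⟨?_, ?_⟩
    · have : (contQ a (k + 2) : ℝ) ≠ 0 := hrec ▸ mul_ne_zero hq' hne
      exact_mod_cast this
    · rw [← hdiv] at hb
      exact hb

theorem digit_of_mem_cylinder {α x : ℝ} {n : ℕ} {a : ℕ → ℤ} (ha : ∀ k, 1 ≤ k → k ≤ n → a k ≠ 0)
    (hx : x ∈ cylinder α n a) {k : ℕ} (hk : k < n) :
    (T α)^[k] x ≠ 0 ∧ a (k + 1) = ⌊1 / (T α)^[k] x + 1 - α⌋ := by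
  have h1 := ha (k + 1) (by omega) (by omega)
  have h2 := hx.2 (k + 1) (by omega) (by omega)
  unfold digit at h2
  rw [Nat.add_sub_cancel] at h2
  split_ifs at h2 with h3
  · exact absurd h2.symm h1
  · exact ⟨h3, h2.symm⟩

/-- For an admissible sequence a_1, …, a_n with continuants q_k:
if α ∈ [1/2, g] then |q_n| > |q_{n−1}|; if α ∈ (g, 1] then
−1/2 < q_{n−1}/q_n < 2, and q_{n−1}/q_n ≥ 1 only if a_n = 1. -/
theorem continuant_growth (α : ℝ) (hα : α ∈ Set.Icc (1 / 2 : ℝ) 1)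
    (n : ℕ) (hn : 1 ≤ n) (a : ℕ → ℤ) (ha : ∀ k, 1 ≤ k → k ≤ n → a k ≠ 0)
    (hadm : (interior (cylinder α n a)).Nonempty) :
    (α ≤ g → |contQ a (n - 1)| < |contQ a n|) ∧
    (g < α →
      (-(1 / 2) : ℝ) < (contQ a (n - 1) : ℝ) / (contQ a n : ℝ) ∧
      (contQ a (n - 1) : ℝ) / (contQ a n : ℝ) < 2 ∧
      (1 ≤ (contQ a (n - 1) : ℝ) / (contQ a n : ℝ) → a n = 1)) := by
  obtain ⟨x, hx⟩ := hadm
  have hx := interior_subset hx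
  have hI := iterate_T_mem_Ico hα hx.1
  obtain ⟨m, rfl⟩ : ∃ m, n = m + 1 := ⟨n - 1, by omega⟩
  rw [Nat.add_sub_cancel]
  refine ⟨fun hg => abs_contQ_lt_succ (n := m + 1) (fun k hk => ?_) m (by omega), fun hg =>
    (contQ_div_succ_bounds (n := m + 1) (fun k hk => ?_) (fun k hk hone => ?_) m (by omega)).2⟩
  · obtain ⟨h0, hd⟩ := digit_of_mem_cylinder ha hx hk
    rcases lt_or_gt_of_ne h0 with h | h
    · have := floor_le_neg_two_of_neg hα (hI k).1 h
      rw [← hd] at this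
      exact le_abs.2 (Or.inr (by omega))
    · have := two_le_floor_of_pos hα hg (hI k).2 h
      rw [← hd] at this
      exact le_abs.2 (Or.inl this)
  · obtain ⟨h0, hd⟩ := digit_of_mem_cylinder ha hx hk
    rw [hd]
    rcases lt_or_gt_of_ne h0 with h | h
    · exact Or.inr (floor_le_neg_three_of_neg hα.2 hg (hI k).1 h)
    · exact Or.inl (one_le_floor_of_pos hα (hI k).2 h)
  · obtain ⟨h0, hd⟩ := digit_of_mem_cylinder ha hx (show k < m + 1 by omega)
    obtain ⟨h0', hd'⟩ := digit_of_mem_cylinder ha hx hk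
    rw [hd']
    refine one_le_floor_of_pos hα (hI (k + 1)).2 (lt_of_le_of_ne ?_ h0'.symm)
    have hpos : 0 < (T α)^[k] x := by
      rcases lt_or_gt_of_ne h0 with h | h
      · have := floor_le_neg_two_of_neg hα (hI k).1 h
        omega
      · exact h
    rw [Function.iterate_succ_apply', T, if_neg h0, ← hd, hone]
    have : 1 ≤ 1 / (T α)^[k] x := by
      rw [le_div_iff₀ hpos]
      linarith [(hI k).2, hα.2]
    push_cast
    linarith
end

section
/- For α ∈ [1/2, 1], there exists a Borel probability measure ν on [α−1, α) that is equivalent to Lebesgue measure and invariant under the jump transformation T̊_α. -/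
open MeasureTheory Set

/-- Lipschitz-type bounds control Lebesgue measure of images. -/
theorem volume_image_le_of_dist_le {f : ℝ → ℝ} {s : Set ℝ} {K : ℝ} (hK : 0 ≤ K)
    (h : ∀ x ∈ s, ∀ y ∈ s, |f x - f y| ≤ K * |x - y|) :
    volume (f '' s) ≤ ENNReal.ofReal K * volume s := by
  have hl : LipschitzOnWith K.toNNReal f s := by
    refine LipschitzOnWith.of_dist_le_mul fun x hx y hy => ?_
    rw [Real.coe_toNNReal K hK, Real.dist_eq, Real.dist_eq]
    exact h x hx y hy
  have := hl.hausdorffMeasure_image_le (d := 1) zero_le_one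
  rw [hausdorffMeasure_real] at this
  simpa [ENNReal.ofReal] using this

theorem volume_le_image_of_dist_le {f : ℝ → ℝ} {s : Set ℝ} {K : ℝ} (hK : 0 ≤ K)
    (h : ∀ x ∈ s, ∀ y ∈ s, |x - y| ≤ K * |f x - f y|) :
    volume s ≤ ENNReal.ofReal K * volume (f '' s) := by
  have hinj : InjOn f s := by
    intro x hx y hy hxy
    have := h x hx y hy
    rw [hxy, sub_self, abs_zero, mul_zero] at this
    exact sub_eq_zero.1 (abs_nonpos_iff.1 this)
  have hleft := hinj.leftInvOn_invFunOn
  have himage : Function.invFunOn f s '' (f '' s) = s := hleft.image_image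
  have key := volume_image_le_of_dist_le (f := Function.invFunOn f s) (s := f '' s) hK (by
    rintro _ ⟨x, hx, rfl⟩ _ ⟨y, hy, rfl⟩
    rw [hleft hx, hleft hy]
    exact h x hx y hy)
  rwa [himage] at key

/-- A quasi-invariant probability measure with uniform two-sided bounds along all iterates
admits an equivalent invariant probability measure. -/
theorem exists_invariant_measure_of_uniform_bounds {X : Type*} [MeasurableSpace X]
    (μ : Measure X) [IsProbabilityMeasure μ] {J : X → X} (hJ : Measurable J)
    {C : ENNReal} (hC : C ≠ ⊤)
    (hle : ∀ k A, MeasurableSet A → μ (J^[k] ⁻¹' A) ≤ C * μ A)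
    (hge : ∀ k A, MeasurableSet A → μ A ≤ C * μ (J^[k] ⁻¹' A)) :
    ∃ ν : Measure X, IsProbabilityMeasure ν ∧ ν ≪ μ ∧ μ ≪ ν ∧ MeasurePreserving J ν ν := by
  classical
  let a : ℕ → Set X → ENNReal := fun n A =>
    ((n : ENNReal) + 1)⁻¹ * ∑ k ∈ Finset.range (n + 1), μ (J^[k] ⁻¹' A)
  let U : Ultrafilter ℕ := Filter.hyperfilter ℕ
  let m : Set X → ENNReal := fun A => (U.map fun n => a n A).lim
  have hpos : ∀ n : ℕ, (n : ENNReal) + 1 ≠ 0 := fun n => by simp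
  have hfin : ∀ n : ℕ, (n : ENNReal) + 1 ≠ ⊤ := fun n => by simp
  have hinv : Filter.Tendsto (fun n : ℕ => ((n : ENNReal) + 1)⁻¹) U (nhds 0) := by
    have h1 : Filter.Tendsto (fun n : ℕ => ((n : ENNReal))⁻¹) Filter.atTop (nhds 0) :=
      ENNReal.tendsto_inv_nat_nhds_zero
    have h2 := (Filter.tendsto_add_atTop_iff_nat 1).2 h1
    refine (Filter.Tendsto.mono_left ?_ Nat.hyperfilter_le_atTop)
    simpa using h2
  have hm : ∀ A, Filter.Tendsto (fun n => a n A) U (nhds (m A)) := fun A =>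
    (U.map fun n => a n A).le_nhds_lim
  have hJk : ∀ k, Measurable (J^[k]) := fun k => hJ.iterate k
  have hconst : ∀ (n : ℕ) (c : ENNReal),
      ((n : ENNReal) + 1)⁻¹ * ∑ _k ∈ Finset.range (n + 1), c = c := by
    intro n c
    rw [Finset.sum_const, Finset.card_range, nsmul_eq_mul, ← mul_assoc]
    push_cast
    rw [ENNReal.inv_mul_cancel (hpos n) (hfin n), one_mul]
  have hmle : ∀ A, MeasurableSet A → m A ≤ C * μ A := by
    intro A hA
    refine le_of_tendsto' (hm A) fun n => ?_
    calc a n A ≤ ((n : ENNReal) + 1)⁻¹ * ∑ _k ∈ Finset.range (n + 1), C * μ A := by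
          refine mul_le_mul_right (Finset.sum_le_sum fun k _ => hle k A hA) _
      _ = C * μ A := hconst n _
  have hmge : ∀ A, MeasurableSet A → μ A ≤ C * m A := by
    intro A hA
    have ht : Filter.Tendsto (fun n => C * a n A) U (nhds (C * m A)) :=
      ENNReal.Tendsto.const_mul (hm A) (Or.inr hC)
    refine ge_of_tendsto' ht fun n => ?_
    calc μ A = ((n : ENNReal) + 1)⁻¹ * ∑ _k ∈ Finset.range (n + 1), μ A := (hconst n _).symm
      _ ≤ ((n : ENNReal) + 1)⁻¹ * ∑ k ∈ Finset.range (n + 1), C * μ (J^[k] ⁻¹' A) := by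
          refine mul_le_mul_right (Finset.sum_le_sum fun k _ => hge k A hA) _
      _ = C * a n A := by
          simp only [a]; rw [← Finset.mul_sum]; ring
  have hempty : m ∅ = 0 := by
    have := hmle ∅ MeasurableSet.empty
    simpa using this
  have huniv : m univ = 1 := by
    refine tendsto_nhds_unique (hm univ) ?_
    have : (fun n => a n univ) = fun _ => 1 := by
      funext n
      simp only [a, preimage_univ, measure_univ]
      exact hconst n 1
    rw [this]
    exact tendsto_const_nhds
  have hunion : ∀ A B, MeasurableSet B → Disjoint A B → m (A ∪ B) = m A + m B := by
    intro A B hB hd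
    refine tendsto_nhds_unique (hm (A ∪ B)) ?_
    have : (fun n => a n (A ∪ B)) = fun n => a n A + a n B := by
      funext n
      simp only [a]
      rw [← mul_add, ← Finset.sum_add_distrib]
      congr 1
      refine Finset.sum_congr rfl fun k _ => ?_
      rw [preimage_union, measure_union (hd.preimage _) (hJk k hB)]
    rw [this]
    exact (hm A).add (hm B)
  have hpre : ∀ A, MeasurableSet A → m (J ⁻¹' A) = m A := by
    intro A _
    have h1 : Filter.Tendsto (fun n : ℕ => a n (J ⁻¹' A) + ((n : ENNReal) + 1)⁻¹ * μ A) U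
        (nhds (m (J ⁻¹' A) + 0 * μ A)) :=
      (hm _).add (ENNReal.Tendsto.mul_const hinv (Or.inr (measure_ne_top μ A)))
    have h3 : Filter.Tendsto (fun n : ℕ => ((n : ENNReal) + 1)⁻¹ * μ (J^[n + 1] ⁻¹' A)) U
        (nhds 0) := by
      refine tendsto_of_tendsto_of_tendsto_of_le_of_le tendsto_const_nhds hinv
        (fun _ => zero_le) fun n => ?_
      calc _ ≤ ((n : ENNReal) + 1)⁻¹ * 1 := mul_le_mul_right prob_le_one _
        _ = _ := mul_one _
    have h2 := (hm A).add h3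
    have heq : (fun n : ℕ => a n (J ⁻¹' A) + ((n : ENNReal) + 1)⁻¹ * μ A)
        = fun n : ℕ => a n A + ((n : ENNReal) + 1)⁻¹ * μ (J^[n + 1] ⁻¹' A) := by
      funext n
      simp only [a]
      rw [← mul_add, ← mul_add]
      congr 1
      have e1 : ∀ k, J^[k] ⁻¹' (J ⁻¹' A) = J^[k + 1] ⁻¹' A := by
        intro k; rw [Function.iterate_succ', preimage_comp]
      simp only [e1]
      rw [← Finset.sum_range_succ (fun k => μ (J^[k] ⁻¹' A)) (n + 1),
        Finset.sum_range_succ' (fun k => μ (J^[k] ⁻¹' A)) (n + 1)]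
      simp
    rw [heq] at h1
    simpa using tendsto_nhds_unique h1 h2
  have hfinset : ∀ (f : ℕ → Set X), (∀ i, MeasurableSet (f i)) → Pairwise (Function.onFun Disjoint f) →
      ∀ N, m (⋃ i, f i) = ∑ i ∈ Finset.range N, m (f i) + m (⋃ i, f (i + N)) := by
    intro f hf hd N
    induction N with
    | zero => simp
    | succ N ih =>
      have hsplit : (⋃ i, f (i + N)) = f N ∪ ⋃ i, f (i + (N + 1)) := by
        ext x
        simp only [mem_iUnion, mem_union]
        constructor
        · rintro ⟨i, hi⟩
          rcases i with _ | i
          · left; simpa using hi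
          · right; exact ⟨i, by rwa [show i + (N + 1) = i + 1 + N by ring]⟩
        · rintro (h | ⟨i, hi⟩)
          · exact ⟨0, by simpa using h⟩
          · exact ⟨i + 1, by rwa [show i + 1 + N = i + (N + 1) by ring]⟩
      have hdisj : Disjoint (f N) (⋃ i, f (i + (N + 1))) := by
        rw [disjoint_iUnion_right]
        intro i
        exact hd (by omega)
      rw [ih, hsplit, hunion _ _ (MeasurableSet.iUnion fun i => hf _) hdisj,
        Finset.sum_range_succ, add_assoc]
  have hiUnion : ∀ ⦃f : ℕ → Set X⦄, (∀ i, MeasurableSet (f i)) →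
      Pairwise (Function.onFun Disjoint f) → m (⋃ i, f i) = ∑' i, m (f i) := by
    intro f hf hd
    have h1 : Filter.Tendsto (fun N => ∑ i ∈ Finset.range N, m (f i)) Filter.atTop
        (nhds (∑' i, m (f i))) := ENNReal.tendsto_nat_tsum _
    have htail : Filter.Tendsto (fun N => m (⋃ i, f (i + N))) Filter.atTop (nhds 0) := by
      have hb : ∀ N, m (⋃ i, f (i + N)) ≤ C * ∑' i, μ (f (i + N)) := fun N =>
        (hmle _ (MeasurableSet.iUnion fun i => hf _)).trans
          (mul_le_mul_right (measure_iUnion_le _) _)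
      have hs : ∑' i, μ (f i) ≠ ⊤ := by
        rw [← measure_iUnion hd hf]; exact measure_ne_top _ _
      have h0 := ENNReal.tendsto_sum_nat_add (fun i => μ (f i)) hs
      have h0' := ENNReal.Tendsto.const_mul (a := C) h0 (Or.inr hC)
      rw [mul_zero] at h0'
      exact tendsto_of_tendsto_of_tendsto_of_le_of_le tendsto_const_nhds h0'
        (fun _ => zero_le) hb
    have h2 := h1.add htail
    rw [add_zero] at h2
    refine tendsto_nhds_unique ?_ h2
    have : (fun N => ∑ i ∈ Finset.range N, m (f i) + m (⋃ i, f (i + N)))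
        = fun _ => m (⋃ i, f i) := funext fun N => (hfinset f hf hd N).symm
    rw [this]
    exact tendsto_const_nhds
  let ν : Measure X := Measure.ofMeasurable (fun A _ => m A) hempty (fun f hf hd => hiUnion hf hd)
  have hν : ∀ A, MeasurableSet A → ν A = m A := fun A hA => Measure.ofMeasurable_apply A hA
  refine ⟨ν, ⟨by rw [hν _ MeasurableSet.univ, huniv]⟩, ?_, ?_, hJ, ?_⟩
  · refine Measure.AbsolutelyContinuous.mk fun A hA h0 => ?_
    have := hmle A hA
    rw [h0, mul_zero] at this
    rw [hν A hA]
    exact le_antisymm this zero_le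
  · refine Measure.AbsolutelyContinuous.mk fun A hA h0 => ?_
    have := hmge A hA
    rw [← hν A hA, h0, mul_zero] at this
    exact le_antisymm this zero_le
  · ext A hA
    rw [Measure.map_apply hJ hA, hν _ (hJ hA), hν A hA, hpre A hA]

/-- The first digit of `x`. -/
noncomputable def firstDigit (α x : ℝ) : ℤ := if x = 0 then 0 else ⌊1 / x + 1 - α⌋

theorem T_eq (α x : ℝ) : T α x = 1 / x - firstDigit α x := by
  unfold T firstDigit
  split_ifs with h <;> simp [h]

theorem T_mem {α : ℝ} (hα : α ∈ Icc (1 / 2 : ℝ) 1) (x : ℝ) : T α x ∈ Ico (α - 1) α := by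
  obtain ⟨h1, h2⟩ := hα
  unfold T
  split_ifs with h
  · constructor <;> linarith
  · have := Int.floor_le (1 / x + 1 - α)
    have := Int.lt_floor_add_one (1 / x + 1 - α)
    constructor <;> linarith

theorem iterate_T_mem {α : ℝ} (hα : α ∈ Icc (1 / 2 : ℝ) 1) {x : ℝ} (hx : x ∈ Ico (α - 1) α) (n : ℕ) :
    (T α)^[n] x ∈ Ico (α - 1) α := by
  cases n with
  | zero => exact hx
  | succ n => rw [Function.iterate_succ_apply']; exact T_mem hα _

theorem firstDigit_eq_of_mem {α x : ℝ} {b : ℤ} (hx : x ≠ 0) (h : 1 / x - b ∈ Ico (α - 1) α) :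
    firstDigit α x = b := by
  rw [firstDigit, if_neg hx, Int.floor_eq_iff]
  constructor <;> linarith [h.1, h.2]

theorem firstDigit_eq_zero_iff {α : ℝ} (hα : α ∈ Icc (1 / 2 : ℝ) 1) {x : ℝ}
    (hx : x ∈ Ico (α - 1) α) : firstDigit α x = 0 ↔ x = 0 := by
  constructor
  · intro h
    by_contra h0
    have hT := T_mem hα x
    rw [T_eq, h] at hT
    obtain ⟨h1, h2⟩ := hα
    obtain ⟨hT1, hT2⟩ := hT
    push_cast at hT1 hT2
    have hx1 : x * (1 / x) = 1 := mul_one_div_cancel h0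
    rcases lt_or_gt_of_ne h0 with hn | hp
    · nlinarith [hx.1]
    · nlinarith [hx.2]
  · rintro rfl; simp [firstDigit]

theorem add_ne_zero_of_mem {α : ℝ} (hα : α ∈ Icc (1 / 2 : ℝ) 1) {b : ℤ} (hb : b ≠ 0) {y : ℝ}
    (hy : y ∈ Ico (α - 1) α) : (b : ℝ) + y ≠ 0 := by
  obtain ⟨h1, h2⟩ := hα
  obtain ⟨h3, h4⟩ := hy
  rcases lt_or_gt_of_ne hb with h | h
  · have : (b : ℝ) ≤ -1 := by exact_mod_cast Int.le_sub_one_of_lt h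
    intro h0; linarith
  · have : (1 : ℝ) ≤ b := by exact_mod_cast h
    intro h0; linarith

theorem firstDigit_inv_add {α : ℝ} (hα : α ∈ Icc (1 / 2 : ℝ) 1) {b : ℤ} (hb : b ≠ 0) {y : ℝ}
    (hy : y ∈ Ico (α - 1) α) : firstDigit α (1 / (b + y)) = b := by
  have h0 := add_ne_zero_of_mem hα hb hy
  refine firstDigit_eq_of_mem (one_div_ne_zero h0) ?_
  rw [one_div_one_div]
  simpa using hy

theorem T_inv_add {α : ℝ} (hα : α ∈ Icc (1 / 2 : ℝ) 1) {b : ℤ} (hb : b ≠ 0) {y : ℝ}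
    (hy : y ∈ Ico (α - 1) α) : T α (1 / (b + y)) = y := by
  rw [T_eq, firstDigit_inv_add hα hb hy, one_div_one_div]
  ring

theorem eq_one_div_add {α x : ℝ} : x = 1 / (firstDigit α x + T α x) := by
  rw [T_eq]; simp

theorem one_le_abs_firstDigit {α : ℝ} (hα : α ∈ Icc (1 / 2 : ℝ) 1) {x : ℝ}
    (hx : x ∈ Ico (α - 1) α) (h0 : 0 < x) : (1 : ℝ) ≤ firstDigit α x := by
  have h1 : firstDigit α x ≠ 0 := by rw [Ne, firstDigit_eq_zero_iff hα hx]; exact h0.ne'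
  have h2 := T_mem hα x
  rw [T_eq] at h2
  have h3 : (0 : ℝ) < 1 / x := by positivity
  have h4 : (-1 : ℝ) < firstDigit α x := by linarith [h2.2, hα.2]
  have h5 : (-1 : ℤ) < firstDigit α x := by exact_mod_cast h4
  have h6 : (1 : ℤ) ≤ firstDigit α x := by omega
  exact_mod_cast h6

theorem abs_le_one_of_mem {α : ℝ} (hα : α ∈ Icc (1 / 2 : ℝ) 1) {x : ℝ}
    (hx : x ∈ Ico (α - 1) α) : |x| ≤ 1 :=
  abs_le.2 ⟨by linarith [hx.1, hα.1], by linarith [hx.2, hα.2]⟩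

theorem abs_mul_abs_le_of_neg {α : ℝ} (hα : α ∈ Icc (1 / 2 : ℝ) 1) {x y : ℝ}
    (hx : x ∈ Ico (α - 1) α) (hy : y ∈ Ico (α - 1) α) (h : x < 0) : |x| * |y| ≤ 1 / 4 := by
  have h1 : |x| ≤ 1 - α := by rw [abs_of_neg h]; linarith [hx.1]
  have h2 : |y| ≤ α := abs_le.2 ⟨by linarith [hy.1, hα.1], hy.2.le⟩
  calc |x| * |y| ≤ (1 - α) * α := mul_le_mul h1 h2 (abs_nonneg _) (by linarith [hα.2])
    _ ≤ 1 / 4 := by nlinarith [sq_nonneg (α - 1 / 2)]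

theorem mul_one_add_T_le {α : ℝ} (hα : α ∈ Icc (1 / 2 : ℝ) 1) {x : ℝ}
    (hx : x ∈ Ico (α - 1) α) (h0 : 0 ≤ x) : x * (1 + T α x) ≤ 1 := by
  rcases h0.eq_or_lt with rfl | h0
  · simp
  · have h1 := one_le_abs_firstDigit hα hx h0
    rw [T_eq]
    have : x * (1 / x) = 1 := mul_one_div_cancel h0.ne'
    nlinarith

/-- Three consecutive steps of an orbit contract by at least a factor of three. -/
theorem abs_mul_three_le {α : ℝ} (hα : α ∈ Icc (1 / 2 : ℝ) 1) {x : ℝ} (hx : x ∈ Ico (α - 1) α) :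
    |x| * |T α x| * |T α (T α x)| ≤ 1 / 3 := by
  have hx1 := T_mem hα x
  have hx2 := T_mem hα (T α x)
  have b0 := abs_le_one_of_mem hα hx
  have b1 := abs_le_one_of_mem hα hx1
  have b2 := abs_le_one_of_mem hα hx2
  have e0 := mul_one_add_T_le hα hx
  have e1 := mul_one_add_T_le hα hx1
  set u := x
  set v := T α x
  set w := T α v
  by_cases hu : u < 0
  · have h1 := abs_mul_abs_le_of_neg hα hx hx1 hu
    nlinarith [abs_nonneg u, abs_nonneg v, abs_nonneg w, mul_nonneg (abs_nonneg u) (abs_nonneg v)]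
  by_cases hv : v < 0
  · have h1 := abs_mul_abs_le_of_neg hα hx1 hx hv
    nlinarith [abs_nonneg u, abs_nonneg v, abs_nonneg w, mul_nonneg (abs_nonneg u) (abs_nonneg v)]
  by_cases hw : w < 0
  · have h1 := abs_mul_abs_le_of_neg hα hx2 hx1 hw
    nlinarith [abs_nonneg u, abs_nonneg v, abs_nonneg w, mul_nonneg (abs_nonneg w) (abs_nonneg v)]
  push Not at hu hv hw
  rw [abs_of_nonneg hu] at *
  rw [abs_of_nonneg hv] at *
  rw [abs_of_nonneg hw] at *
  have h0 := e0 hu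
  have h1 := e1 hv
  have h2 : u * v * w ≤ u * v := mul_le_of_le_one_right (mul_nonneg hu hv) b2
  have h3 : u * (v * (1 + w)) ≤ u * 1 := mul_le_mul_of_nonneg_left h1 hu
  nlinarith

theorem abs_sub_eq_mul {α : ℝ} {x y : ℝ} (hx : x ≠ 0) (hy : y ≠ 0)
    (h : firstDigit α x = firstDigit α y) : |x - y| = |x| * |y| * |T α x - T α y| := by
  rw [T_eq, T_eq, h, ← abs_mul, ← abs_mul]
  rw [show (1 / x - (firstDigit α y : ℝ) - (1 / y - firstDigit α y)) = 1 / x - 1 / y by ring]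
  rw [abs_sub_comm]
  congr 1
  field_simp

theorem abs_sub_eq_prod {α : ℝ} {x y : ℝ} {n : ℕ}
    (hx : ∀ k < n, (T α)^[k] x ≠ 0) (hy : ∀ k < n, (T α)^[k] y ≠ 0)
    (h : ∀ k < n, firstDigit α ((T α)^[k] x) = firstDigit α ((T α)^[k] y)) :
    |x - y| = (∏ k ∈ Finset.range n, |(T α)^[k] x|) * (∏ k ∈ Finset.range n, |(T α)^[k] y|) *
      |(T α)^[n] x - (T α)^[n] y| := by
  induction n with
  | zero => simp
  | succ n ih =>
    rw [ih (fun k hk => hx k (by omega)) (fun k hk => hy k (by omega)) (fun k hk => h k (by omega)),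
      Finset.prod_range_succ, Finset.prod_range_succ,
      abs_sub_eq_mul (hx n (by omega)) (hy n (by omega)) (h n (by omega)),
      Function.iterate_succ_apply', Function.iterate_succ_apply']
    ring

theorem abs_sub_le_three_step {α : ℝ} (hα : α ∈ Icc (1 / 2 : ℝ) 1) {x y : ℝ}
    (hxI : x ∈ Ico (α - 1) α) (hyI : y ∈ Ico (α - 1) α)
    (hx : ∀ k < 3, (T α)^[k] x ≠ 0) (hy : ∀ k < 3, (T α)^[k] y ≠ 0)
    (h : ∀ k < 3, firstDigit α ((T α)^[k] x) = firstDigit α ((T α)^[k] y)) :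
    |x - y| ≤ |(T α)^[3] x - (T α)^[3] y| / 9 := by
  rw [abs_sub_eq_prod hx hy h]
  have h1 : ∀ z ∈ Ico (α - 1) α, ∏ k ∈ Finset.range 3, |(T α)^[k] z| ≤ 1 / 3 := by
    intro z hz
    simpa [Finset.prod_range_succ] using abs_mul_three_le hα hz
  have h2 : ∀ z : ℝ, 0 ≤ ∏ k ∈ Finset.range 3, |(T α)^[k] z| := fun z =>
    Finset.prod_nonneg fun _ _ => abs_nonneg _
  have := mul_le_mul (h1 x hxI) (h1 y hyI) (h2 y) (by norm_num)
  nlinarith [abs_nonneg ((T α)^[3] x - (T α)^[3] y)]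

theorem abs_sub_le_one_of_mem {α x y : ℝ} (hx : x ∈ Ico (α - 1) α) (hy : y ∈ Ico (α - 1) α) :
    |x - y| ≤ 1 :=
  abs_le.2 ⟨by linarith [hx.1, hy.2], by linarith [hx.2, hy.1]⟩

theorem abs_sub_le_pow {α : ℝ} (hα : α ∈ Icc (1 / 2 : ℝ) 1) (n : ℕ) : ∀ {x y : ℝ},
    x ∈ Ico (α - 1) α → y ∈ Ico (α - 1) α →
    (∀ k < 3 * n, (T α)^[k] x ≠ 0) → (∀ k < 3 * n, (T α)^[k] y ≠ 0) →
    (∀ k < 3 * n, firstDigit α ((T α)^[k] x) = firstDigit α ((T α)^[k] y)) →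
    |x - y| ≤ (1 / 9) ^ n := by
  induction n with
  | zero => intro x y hx hy _ _ _; simpa using abs_sub_le_one_of_mem hx hy
  | succ n ih =>
    intro x y hxI hyI hx hy h
    have h1 := abs_sub_le_three_step hα hxI hyI (fun k hk => hx k (by omega))
      (fun k hk => hy k (by omega)) (fun k hk => h k (by omega))
    have h2 := ih (iterate_T_mem hα hxI 3) (iterate_T_mem hα hyI 3)
      (fun k hk => by rw [← Function.iterate_add_apply]; exact hx _ (by omega))
      (fun k hk => by rw [← Function.iterate_add_apply]; exact hy _ (by omega))
      (fun k hk => by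
        rw [← Function.iterate_add_apply, ← Function.iterate_add_apply]; exact h _ (by omega))
    rw [pow_succ]
    linarith

theorem sum_le_four_of_contracting {δ : ℕ → ℝ} {n : ℕ} (h0 : ∀ k, 0 ≤ δ k) (h1 : ∀ k, δ k ≤ 1)
    (h3 : ∀ k, k + 3 ≤ n → δ k ≤ δ (k + 3) / 9) : ∑ k ∈ Finset.range (n + 1), δ k ≤ 4 := by
  have key : ∀ m, m + 2 ≤ n → ∑ k ∈ Finset.range (m + 3), δ k
      ≤ 9 / 8 * (δ m + δ (m + 1) + δ (m + 2)) := by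
    intro m
    induction m with
    | zero =>
      intro _
      simp only [Finset.sum_range_succ, Finset.range_zero, Finset.sum_empty]
      nlinarith [h0 0, h0 1, h0 2]
    | succ m ih =>
      intro hm
      rw [Finset.sum_range_succ]
      have := ih (by omega)
      have := h3 m (by omega)
      have e1 : m + 1 + 1 = m + 2 := rfl
      have e2 : m + 1 + 2 = m + 3 := rfl
      rw [e1, e2]
      have e3 : m + 1 + 3 = m + 4 := rfl
      linarith
  rcases Nat.lt_or_ge n 2 with hn | hn
  · calc ∑ k ∈ Finset.range (n + 1), δ k ≤ ∑ k ∈ Finset.range (n + 1), (1 : ℝ) :=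
        Finset.sum_le_sum fun k _ => h1 k
      _ = n + 1 := by simp
      _ ≤ 4 := by
        have : (n : ℝ) < 2 := by exact_mod_cast hn
        linarith
  · obtain ⟨m, rfl⟩ := Nat.exists_eq_add_of_le' hn
    have := key m le_rfl
    have a := h1 m
    have b := h1 (m + 1)
    have c := h1 (m + 2)
    calc _ ≤ _ := this
      _ ≤ 4 := by linarith

/-- Bounded distortion along a cylinder. -/
theorem prod_abs_le {α : ℝ} (hα : α ∈ Icc (1 / 2 : ℝ) 1) {x y : ℝ} {n : ℕ}
    (hxI : x ∈ Ico (α - 1) α) (hyI : y ∈ Ico (α - 1) α)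
    (hx : ∀ k < n, (T α)^[k] x ≠ 0) (hy : ∀ k < n, (T α)^[k] y ≠ 0)
    (h : ∀ k < n, firstDigit α ((T α)^[k] x) = firstDigit α ((T α)^[k] y)) :
    ∏ k ∈ Finset.range n, |(T α)^[k] x|
      ≤ Real.exp 4 * ∏ k ∈ Finset.range n, |(T α)^[k] y| := by
  set δ : ℕ → ℝ := fun k => |(T α)^[k] x - (T α)^[k] y| with hδ
  have hsum : ∑ k ∈ Finset.range (n + 1), δ k ≤ 4 := by
    refine sum_le_four_of_contracting (fun k => abs_nonneg _)
      (fun k => abs_sub_le_one_of_mem (iterate_T_mem hα hxI k) (iterate_T_mem hα hyI k)) ?_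
    intro k hk
    have := abs_sub_le_three_step hα (iterate_T_mem hα hxI k) (iterate_T_mem hα hyI k)
      (fun j hj => by rw [← Function.iterate_add_apply]; exact hx _ (by omega))
      (fun j hj => by rw [← Function.iterate_add_apply]; exact hy _ (by omega))
      (fun j hj => by
        rw [← Function.iterate_add_apply, ← Function.iterate_add_apply]; exact h _ (by omega))
    rw [← Function.iterate_add_apply, ← Function.iterate_add_apply, add_comm 3 k] at this
    exact this
  have hstep : ∀ k < n, |(T α)^[k] x| ≤ Real.exp (δ (k + 1)) * |(T α)^[k] y| := by
    intro k hk
    have h1 := abs_sub_eq_mul (hx k hk) (hy k hk) (h k hk)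
    rw [← Function.iterate_succ_apply' (T α) k x, ← Function.iterate_succ_apply' (T α) k y] at h1
    have h2 : |(T α)^[k] x| ≤ |(T α)^[k] y| + |(T α)^[k] x - (T α)^[k] y| := by
      have := abs_add_le ((T α)^[k] y) ((T α)^[k] x - (T α)^[k] y)
      simpa using this
    have h3 := abs_le_one_of_mem hα (iterate_T_mem hα hxI k)
    have h4 : |(T α)^[k] x - (T α)^[k] y| ≤ |(T α)^[k] y| * δ (k + 1) := by
      rw [h1, mul_assoc]
      exact mul_le_of_le_one_left (mul_nonneg (abs_nonneg _) (abs_nonneg _)) h3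
    have h5 := Real.add_one_le_exp (δ (k + 1))
    nlinarith [abs_nonneg ((T α)^[k] y)]
  calc ∏ k ∈ Finset.range n, |(T α)^[k] x|
      ≤ ∏ k ∈ Finset.range n, (Real.exp (δ (k + 1)) * |(T α)^[k] y|) :=
        Finset.prod_le_prod (fun _ _ => abs_nonneg _) fun k hk => hstep k (Finset.mem_range.1 hk)
    _ = Real.exp (∑ k ∈ Finset.range n, δ (k + 1)) * ∏ k ∈ Finset.range n, |(T α)^[k] y| := by
        rw [Finset.prod_mul_distrib, Real.exp_sum]
    _ ≤ Real.exp 4 * ∏ k ∈ Finset.range n, |(T α)^[k] y| := by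
        refine mul_le_mul_of_nonneg_right (Real.exp_le_exp.2 ?_)
          (Finset.prod_nonneg fun _ _ => abs_nonneg _)
        rw [Finset.sum_range_succ'] at hsum
        linarith [abs_nonneg ((T α)^[0] x - (T α)^[0] y)]

theorem one_div_le_one_div_of_mul_pos {s t u : ℝ} (h : 0 < s * u) (h1 : s ≤ t) (h2 : t ≤ u) :
    t ≠ 0 ∧ 1 / u ≤ 1 / t ∧ 1 / t ≤ 1 / s := by
  rcases pos_and_pos_or_neg_and_neg_of_mul_pos h with ⟨hs, hu⟩ | ⟨hs, hu⟩
  · have ht : 0 < t := lt_of_lt_of_le hs h1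
    exact ⟨ht.ne', one_div_le_one_div_of_le ht h2, one_div_le_one_div_of_le hs h1⟩
  · have ht : t < 0 := lt_of_le_of_lt h2 hu
    exact ⟨ht.ne, one_div_le_one_div_of_neg_of_le hu h2, one_div_le_one_div_of_neg_of_le ht h1⟩

theorem add_mul_add_pos {α : ℝ} (hα : α ∈ Icc (1 / 2 : ℝ) 1) {b : ℤ} (hb : b ≠ 0) {y z : ℝ}
    (hy : y ∈ Ico (α - 1) α) (hz : z ∈ Ico (α - 1) α) : 0 < ((b : ℝ) + y) * (b + z) := by
  obtain ⟨h1, h2⟩ := hα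
  rcases lt_or_gt_of_ne hb with h | h
  · have : (b : ℝ) ≤ -1 := by exact_mod_cast Int.le_sub_one_of_lt h
    exact mul_pos_of_neg_of_neg (by linarith [hy.2]) (by linarith [hz.2])
  · have : (1 : ℝ) ≤ b := by exact_mod_cast h
    exact mul_pos (by linarith [hy.1]) (by linarith [hz.1])

/-- Between two points of a branch domain every point lies in the same branch domain. -/
theorem firstDigit_eq_of_between {α : ℝ} (hα : α ∈ Icc (1 / 2 : ℝ) 1) {b : ℤ} (hb : b ≠ 0)
    {z w x : ℝ} (hz : z ∈ Ico (α - 1) α) (hw : w ∈ Ico (α - 1) α)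
    (h1 : 1 / (b + z) ≤ x) (h2 : x ≤ 1 / (b + w)) : firstDigit α x = b := by
  have hpos : 0 < (1 / ((b : ℝ) + z)) * (1 / (b + w)) := by
    rw [div_mul_div_comm, one_mul]
    exact one_div_pos.2 (add_mul_add_pos hα hb hz hw)
  obtain ⟨h0, h3, h4⟩ := one_div_le_one_div_of_mul_pos hpos h1 h2
  rw [one_div_one_div] at h3 h4
  exact firstDigit_eq_of_mem h0 ⟨by linarith [hw.1], by linarith [hz.2]⟩

/-- The image under `T α` of the points of `J` with first digit `b`. -/
def branchImage (α : ℝ) (J : Set ℝ) (b : ℤ) : Set ℝ := T α '' {y | y ∈ J ∧ firstDigit α y = b}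

theorem mem_branchImage_iff {α : ℝ} (hα : α ∈ Icc (1 / 2 : ℝ) 1) {J : Set ℝ} {b : ℤ} (hb : b ≠ 0)
    {z : ℝ} : z ∈ branchImage α J b ↔ z ∈ Ico (α - 1) α ∧ 1 / (b + z) ∈ J := by
  constructor
  · rintro ⟨y, ⟨hy, hd⟩, rfl⟩
    refine ⟨T_mem hα y, ?_⟩
    rw [← hd, ← eq_one_div_add]
    exact hy
  · rintro ⟨hz, hJ⟩
    exact ⟨_, ⟨hJ, firstDigit_inv_add hα hb hz⟩, T_inv_add hα hb hz⟩

theorem branchImage_subset {α : ℝ} (hα : α ∈ Icc (1 / 2 : ℝ) 1) {J : Set ℝ} {b : ℤ} :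
    branchImage α J b ⊆ Ico (α - 1) α := by
  rintro _ ⟨y, _, rfl⟩
  exact T_mem hα y

theorem ordConnected_branchImage {α : ℝ} (hα : α ∈ Icc (1 / 2 : ℝ) 1) {J : Set ℝ}
    (hJ : J.OrdConnected) {b : ℤ} (hb : b ≠ 0) : (branchImage α J b).OrdConnected := by
  refine ⟨fun u hu v hv z hz => ?_⟩
  rw [mem_branchImage_iff hα hb] at hu hv ⊢
  refine ⟨⟨hu.1.1.trans hz.1, hz.2.trans_lt hv.1.2⟩, ?_⟩
  obtain ⟨-, h3, h4⟩ := one_div_le_one_div_of_mul_pos (add_mul_add_pos hα hb hu.1 hv.1)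
    (add_le_add_right hz.1 (b : ℝ)) (add_le_add_right hz.2 (b : ℝ))
  exact hJ.out hv.2 hu.2 ⟨h3, h4⟩

/-- At most two branches meet an interval without mapping their part of it onto everything. -/
theorem exists_two_nonfull_branches {α : ℝ} (hα : α ∈ Icc (1 / 2 : ℝ) 1) {J : Set ℝ}
    (hJ : J.OrdConnected) : ∃ b₁ b₂ : ℤ, ∀ b : ℤ, b ≠ 0 →
      (∃ y ∈ J, firstDigit α y = b) → branchImage α J b ≠ Ico (α - 1) α → b = b₁ ∨ b = b₂ := by
  let low : ℤ → Prop := fun b => b ≠ 0 ∧ (∃ y ∈ J, firstDigit α y = b) ∧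
    ∃ z ∈ Ico (α - 1) α, ∀ y ∈ J, 1 / (b + z) < y
  let high : ℤ → Prop := fun b => b ≠ 0 ∧ (∃ y ∈ J, firstDigit α y = b) ∧
    ∃ z ∈ Ico (α - 1) α, ∀ y ∈ J, y < 1 / (b + z)
  have hlow : ∀ b c, low b → low c → b = c := by
    have aux : ∀ b c, low b → low c → ∀ z ∈ Ico (α - 1) α, ∀ w ∈ Ico (α - 1) α,
        (∀ y ∈ J, 1 / ((c : ℝ) + w) < y) → 1 / ((b : ℝ) + z) ≤ 1 / (c + w) → b = c := by
      rintro b c ⟨hb, ⟨y, hyJ, hyb⟩, -⟩ ⟨hc, -, -⟩ z hz w hw hw' hzw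
      have hy := hw' y hyJ
      rw [eq_one_div_add (α := α) (x := y), hyb] at hy
      rw [← firstDigit_eq_of_between hα hb hz (T_mem hα y) hzw hy.le, firstDigit_inv_add hα hc hw]
    intro b c hb hc
    obtain ⟨z, hz, hz'⟩ := hb.2.2
    obtain ⟨w, hw, hw'⟩ := hc.2.2
    rcases le_total (1 / ((b : ℝ) + z)) (1 / (c + w)) with h | h
    · exact aux b c hb hc z hz w hw hw' h
    · exact (aux c b hc hb w hw z hz hz' h).symm
  have hhigh : ∀ b c, high b → high c → b = c := by
    have aux : ∀ b c, high b → high c → ∀ z ∈ Ico (α - 1) α, ∀ w ∈ Ico (α - 1) α,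
        (∀ y ∈ J, y < 1 / ((c : ℝ) + w)) → 1 / ((c : ℝ) + w) ≤ 1 / (b + z) → b = c := by
      rintro b c ⟨hb, ⟨y, hyJ, hyb⟩, -⟩ ⟨hc, -, -⟩ z hz w hw hw' hzw
      have hy := hw' y hyJ
      rw [eq_one_div_add (α := α) (x := y), hyb] at hy
      rw [← firstDigit_eq_of_between hα hb (T_mem hα y) hz hy.le hzw, firstDigit_inv_add hα hc hw]
    intro b c hb hc
    obtain ⟨z, hz, hz'⟩ := hb.2.2
    obtain ⟨w, hw, hw'⟩ := hc.2.2
    rcases le_total (1 / ((b : ℝ) + z)) (1 / (c + w)) with h | h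
    · exact (aux c b hc hb w hw z hz hz' h).symm
    · exact aux b c hb hc z hz w hw hw' h
  have hor : ∀ b : ℤ, b ≠ 0 → (∃ y ∈ J, firstDigit α y = b) →
      branchImage α J b ≠ Ico (α - 1) α → low b ∨ high b := by
    intro b hb hy hne
    obtain ⟨z, hz, hzJ⟩ : ∃ z ∈ Ico (α - 1) α, 1 / ((b : ℝ) + z) ∉ J := by
      by_contra! hcon
      exact hne (Subset.antisymm (branchImage_subset hα)
        fun z hz => (mem_branchImage_iff hα hb).2 ⟨hz, hcon z hz⟩)
    by_contra! hcon
    obtain ⟨h1, h2⟩ := hcon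
    have h1' : ∃ y ∈ J, y ≤ 1 / ((b : ℝ) + z) := by
      by_contra! h; exact h1 ⟨hb, hy, z, hz, h⟩
    have h2' : ∃ y ∈ J, 1 / ((b : ℝ) + z) ≤ y := by
      by_contra! h; exact h2 ⟨hb, hy, z, hz, h⟩
    obtain ⟨y, hyJ, hy1⟩ := h1'
    obtain ⟨y', hyJ', hy2⟩ := h2'
    exact hzJ (hJ.out hyJ hyJ' ⟨hy1, hy2⟩)
  have hex : ∀ p : ℤ → Prop, (∀ b c, p b → p c → b = c) → ∃ b₀, ∀ b, p b → b = b₀ := by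
    intro p hp
    by_cases h : ∃ b, p b
    · obtain ⟨b₀, h₀⟩ := h
      exact ⟨b₀, fun b hb => hp b b₀ hb h₀⟩
    · exact ⟨0, fun b hb => absurd ⟨b, hb⟩ h⟩
  obtain ⟨b₁, h₁⟩ := hex low hlow
  obtain ⟨b₂, h₂⟩ := hex high hhigh
  exact ⟨b₁, b₂, fun b hb hy hne => (hor b hb hy hne).imp (h₁ b) (h₂ b)⟩

/-- Points without full cylinder up to order `n` are covered by at most `2 ^ n` sets on each of
which the first `n` digits are nonzero and constant. -/
theorem exists_cover_of_nonfull {α : ℝ} (hα : α ∈ Icc (1 / 2 : ℝ) 1) (n : ℕ) : ∀ J : Set ℝ,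
    J.OrdConnected → J ⊆ Ico (α - 1) α → ∃ F : Finset (Set ℝ), F.card ≤ 2 ^ n ∧
      (∀ S ∈ F, ∀ x ∈ S, x ∈ Ico (α - 1) α ∧ (∀ k < n, (T α)^[k] x ≠ 0) ∧
        ∀ y ∈ S, ∀ k < n, firstDigit α ((T α)^[k] x) = firstDigit α ((T α)^[k] y)) ∧
      ∀ x ∈ J, (∀ k < n, (T α)^[k] x ≠ 0) →
        (∀ m, 1 ≤ m → m ≤ n → (T α)^[m] '' {y | y ∈ J ∧ ∀ k < m,
          firstDigit α ((T α)^[k] y) = firstDigit α ((T α)^[k] x)} ≠ Ico (α - 1) α) →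
        ∃ S ∈ F, x ∈ S := by
  classical
  induction n with
  | zero =>
    intro J _ hJI
    exact ⟨{J}, by simp, by simpa using fun x hx => hJI hx, fun x hx _ _ => ⟨J, by simp, hx⟩⟩
  | succ n ih =>
    intro J hJ hJI
    obtain ⟨b₁, b₂, hb⟩ := exists_two_nonfull_branches hα hJ
    have hF : ∀ b : ℤ, ∃ F : Finset (Set ℝ), F.card ≤ 2 ^ n ∧
      (∀ S ∈ F, ∀ x ∈ S, x ∈ Ico (α - 1) α ∧ (∀ k < n + 1, (T α)^[k] x ≠ 0) ∧
        ∀ y ∈ S, ∀ k < n + 1, firstDigit α ((T α)^[k] x) = firstDigit α ((T α)^[k] y)) ∧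
      (b ≠ 0 → ∀ x ∈ J, firstDigit α x = b → (∀ k < n + 1, (T α)^[k] x ≠ 0) →
        (∀ m, 1 ≤ m → m ≤ n + 1 → (T α)^[m] '' {y | y ∈ J ∧ ∀ k < m,
          firstDigit α ((T α)^[k] y) = firstDigit α ((T α)^[k] x)} ≠ Ico (α - 1) α) →
        ∃ S ∈ F, x ∈ S) := by
      intro b
      by_cases hb0 : b = 0
      · exact ⟨∅, by simp, by simp, fun h => absurd hb0 h⟩
      obtain ⟨F, hc, hS, hcov⟩ := ih (branchImage α J b) (ordConnected_branchImage hα hJ hb0)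
        (branchImage_subset hα)
      refine ⟨F.image fun S => {x | x ∈ Ico (α - 1) α ∧ x ≠ 0 ∧ firstDigit α x = b ∧ T α x ∈ S},
        Finset.card_image_le.trans hc, ?_, ?_⟩
      · intro S' hS'
        obtain ⟨S, hSF, rfl⟩ := Finset.mem_image.1 hS'
        rintro x ⟨hxI, hx0, hxb, hxS⟩
        obtain ⟨h1, h2, h3⟩ := hS S hSF _ hxS
        refine ⟨hxI, ?_, ?_⟩
        · rintro (_ | k) hk
          · exact hx0
          · exact h2 k (by omega)
        · rintro y ⟨hyI, hy0, hyb, hyS⟩ (_ | k) hk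
          · exact hxb.trans hyb.symm
          · exact h3 _ hyS k (by omega)
      · intro _ x hxJ hxb hx0 hxm
        obtain ⟨S, hSF, hxS⟩ := hcov (T α x) ⟨x, ⟨hxJ, hxb⟩, rfl⟩ (fun k hk => hx0 (k + 1) (by omega))
          (fun m hm1 hm2 => by
            have := hxm (m + 1) (by omega) (by omega)
            intro heq
            apply this
            rw [← heq, Function.iterate_succ, image_comp]
            congr 1
            ext z
            constructor
            · rintro ⟨y, ⟨hyJ, hyd⟩, rfl⟩
              exact ⟨⟨y, ⟨hyJ, (hyd 0 (by omega)).trans hxb⟩, rfl⟩,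
                fun k hk => hyd (k + 1) (by omega)⟩
            · rintro ⟨⟨y, ⟨hyJ, hyb⟩, rfl⟩, hyd⟩
              refine ⟨y, ⟨hyJ, ?_⟩, rfl⟩
              rintro (_ | k) hk
              · exact hyb.trans hxb.symm
              · exact hyd k (by omega))
        exact ⟨_, Finset.mem_image_of_mem _ hSF, hJI hxJ, hx0 0 (by omega), hxb, hxS⟩
    obtain ⟨F₁, hc₁, hS₁, hcov₁⟩ := hF b₁
    obtain ⟨F₂, hc₂, hS₂, hcov₂⟩ := hF b₂
    refine ⟨F₁ ∪ F₂, ?_, ?_, ?_⟩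
    · have := Finset.card_union_le F₁ F₂
      rw [pow_succ]; omega
    · intro S hS
      rcases Finset.mem_union.1 hS with h | h
      · exact hS₁ S h
      · exact hS₂ S h
    · intro x hxJ hx0 hxm
      have hd0 : firstDigit α x ≠ 0 := by
        rw [Ne, firstDigit_eq_zero_iff hα (hJI hxJ)]; exact hx0 0 (by omega)
      have hne : branchImage α J (firstDigit α x) ≠ Ico (α - 1) α := by
        have := hxm 1 le_rfl (by omega)
        simpa [branchImage] using this
      rcases hb _ hd0 ⟨x, hxJ, rfl⟩ hne with h | h
      · obtain ⟨S, hS, hx⟩ := hcov₁ (h ▸ hd0) x hxJ h hx0 hxm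
        exact ⟨S, Finset.mem_union_left _ hS, hx⟩
      · obtain ⟨S, hS, hx⟩ := hcov₂ (h ▸ hd0) x hxJ h hx0 hxm
        exact ⟨S, Finset.mem_union_right _ hS, hx⟩

/-- The cylinder of order `n` around `x`. -/
def cylinderAt (α : ℝ) (n : ℕ) (x : ℝ) : Set ℝ := cylinder α n (fun k => digit α k x)

theorem mem_cylinderAt_iff {α : ℝ} {n : ℕ} {x y : ℝ} : y ∈ cylinderAt α n x ↔
    y ∈ Ico (α - 1) α ∧ ∀ k < n, firstDigit α ((T α)^[k] y) = firstDigit α ((T α)^[k] x) := by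
  refine and_congr_right fun _ => ⟨fun h k hk => h (k + 1) (by omega) (by omega), ?_⟩
  rintro h (_ | k) hk1 hk2
  · omega
  · exact h k (by omega)

theorem volume_nonfull_eq_zero {α : ℝ} (hα : α ∈ Icc (1 / 2 : ℝ) 1) :
    volume {x | x ∈ Ico (α - 1) α ∧ (∀ k, (T α)^[k] x ≠ 0) ∧
      ∀ m, 1 ≤ m → (T α)^[m] '' cylinderAt α m x ≠ Ico (α - 1) α} = 0 := by
  set B := {x | x ∈ Ico (α - 1) α ∧ (∀ k, (T α)^[k] x ≠ 0) ∧
      ∀ m, 1 ≤ m → (T α)^[m] '' cylinderAt α m x ≠ Ico (α - 1) α} with hB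
  have hbound : ∀ n : ℕ, volume B ≤ ENNReal.ofReal ((8 / 9) ^ n) := by
    intro n
    obtain ⟨F, hc, hS, hcov⟩ := exists_cover_of_nonfull hα (3 * n) (Ico (α - 1) α)
      ordConnected_Ico le_rfl
    have hsub : B ⊆ ⋃ S ∈ F, S := by
      rintro x ⟨hxI, hx0, hxm⟩
      obtain ⟨S, hSF, hxS⟩ := hcov x hxI (fun k _ => hx0 k) (fun m hm _ => by
        have h := hxm m hm
        have he : cylinderAt α m x = {y | y ∈ Ico (α - 1) α ∧ ∀ k < m,
          firstDigit α ((T α)^[k] y) = firstDigit α ((T α)^[k] x)} := by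
          ext y; exact mem_cylinderAt_iff
        rwa [he] at h)
      exact mem_biUnion hSF hxS
    have hvol : ∀ S ∈ F, volume S ≤ ENNReal.ofReal ((1 / 9) ^ n) := by
      intro S hSF
      refine (Real.volume_le_diam S).trans (Metric.ediam_le fun x hx y hy => ?_)
      rw [edist_dist, Real.dist_eq]
      obtain ⟨h1, h2, h3⟩ := hS S hSF x hx
      obtain ⟨h4, h5, -⟩ := hS S hSF y hy
      exact ENNReal.ofReal_le_ofReal (abs_sub_le_pow hα n h1 h4 h2 h5 (h3 y hy))
    calc volume B ≤ volume (⋃ S ∈ F, S) := measure_mono hsub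
      _ ≤ ∑ S ∈ F, volume S := measure_biUnion_finset_le _ _
      _ ≤ ∑ _S ∈ F, ENNReal.ofReal ((1 / 9) ^ n) := Finset.sum_le_sum hvol
      _ = F.card * ENNReal.ofReal ((1 / 9) ^ n) := by rw [Finset.sum_const, nsmul_eq_mul]
      _ ≤ ((8 ^ n : ℕ) : ENNReal) * ENNReal.ofReal ((1 / 9) ^ n) := by
        gcongr
        rwa [pow_mul] at hc
      _ = ENNReal.ofReal ((8 / 9) ^ n) := by
        rw [← ENNReal.ofReal_natCast, ← ENNReal.ofReal_mul (by positivity)]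
        congr 1
        push_cast
        rw [← mul_pow]
        norm_num
  have hlim : Filter.Tendsto (fun n : ℕ => ENNReal.ofReal ((8 / 9) ^ n)) Filter.atTop (nhds 0) := by
    rw [← ENNReal.ofReal_zero]
    exact ENNReal.tendsto_ofReal (tendsto_pow_atTop_nhds_zero_of_lt_one (by norm_num) (by norm_num))
  exact le_antisymm (ge_of_tendsto' hlim hbound) zero_le

theorem measurable_firstDigit (α : ℝ) : Measurable (firstDigit α) := by
  unfold firstDigit
  refine Measurable.ite (measurableSet_singleton 0) measurable_const (Measurable.floor ?_)
  fun_prop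

theorem measurable_T (α : ℝ) : Measurable (T α) := by
  have h := measurable_firstDigit α
  have : T α = fun x => 1 / x - (firstDigit α x : ℝ) := funext (T_eq α)
  rw [this]
  have h2 : Measurable fun x => (firstDigit α x : ℝ) := measurable_from_top.comp h
  fun_prop

theorem cylinderAt_congr {α : ℝ} {n : ℕ} {x y : ℝ}
    (h : ∀ k < n, firstDigit α ((T α)^[k] y) = firstDigit α ((T α)^[k] x)) :
    cylinderAt α n y = cylinderAt α n x := by
  ext z
  rw [mem_cylinderAt_iff, mem_cylinderAt_iff]
  refine and_congr_right fun _ => forall₂_congr fun k hk => ?_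
  rw [h k hk]

theorem cylinderAt_eq_of_mem {α : ℝ} {n m : ℕ} {x y : ℝ} (hy : y ∈ cylinderAt α n x)
    (hm : m ≤ n) : cylinderAt α m y = cylinderAt α m x :=
  cylinderAt_congr fun k hk => (mem_cylinderAt_iff.1 hy).2 k (by omega)

theorem self_mem_cylinderAt {α : ℝ} {n : ℕ} {x : ℝ} (hx : x ∈ Ico (α - 1) α) :
    x ∈ cylinderAt α n x := mem_cylinderAt_iff.2 ⟨hx, fun _ _ => rfl⟩

theorem measurableSet_cylinderAt (α : ℝ) (n : ℕ) (x : ℝ) : MeasurableSet (cylinderAt α n x) := by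
  have : cylinderAt α n x = Ico (α - 1) α ∩ ⋂ k : ℕ, ⋂ _ : k < n,
      (fun y => firstDigit α ((T α)^[k] y)) ⁻¹' {firstDigit α ((T α)^[k] x)} := by
    ext y
    rw [mem_cylinderAt_iff]
    simp
  rw [this]
  exact measurableSet_Ico.inter (MeasurableSet.iInter fun k => MeasurableSet.iInter fun _ =>
    ((measurable_firstDigit α).comp ((measurable_T α).iterate k)) (measurableSet_singleton _))

theorem countable_range_cylinderAt (α : ℝ) :
    (range fun p : ℕ × ℝ => cylinderAt α p.1 p.2).Countable := by
  let Φ : (Σ n : ℕ, Fin n → ℤ) → Set ℝ := fun s =>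
    {y | y ∈ Ico (α - 1) α ∧ ∀ k : Fin s.1, firstDigit α ((T α)^[k] y) = s.2 k}
  refine (countable_range Φ).mono ?_
  rintro _ ⟨⟨n, x⟩, rfl⟩
  refine ⟨⟨n, fun k => firstDigit α ((T α)^[k] x)⟩, ?_⟩
  ext y
  simp only [mem_cylinderAt_iff, Φ]
  exact and_congr_right fun _ => ⟨fun h k hk => h ⟨k, hk⟩, fun h k => h k k.2⟩

/-- The cylinder of order `n` around `x` is full. -/
def IsFullAt (α : ℝ) (n : ℕ) (x : ℝ) : Prop := (T α)^[n] '' cylinderAt α n x = Ico (α - 1) α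

theorem measurableSet_isFullAt (α : ℝ) (n : ℕ) : MeasurableSet {x | IsFullAt α n x} := by
  let φ : ℝ → Fin n → ℤ := fun x k => firstDigit α ((T α)^[k] x)
  have hφ : Measurable φ := measurable_pi_lambda _ fun k =>
    (measurable_firstDigit α).comp ((measurable_T α).iterate k)
  have : {x | IsFullAt α n x} = φ ⁻¹' (φ '' {x | IsFullAt α n x}) := by
    refine Subset.antisymm (subset_preimage_image _ _) ?_
    rintro x ⟨y, hy, hxy⟩
    have : cylinderAt α n y = cylinderAt α n x :=
      cylinderAt_congr fun k hk => congrFun hxy ⟨k, hk⟩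
    simpa only [mem_ofPred_eq, IsFullAt, this] using hy
  rw [this]
  exact hφ MeasurableSet.of_discrete

theorem jumpTime_eq_sInf (α x : ℝ) : jumpTime α x = sInf {n | 1 ≤ n ∧ IsFullAt α n x} := rfl

theorem jumpTime_ne_zero_iff {α x : ℝ} : jumpTime α x ≠ 0 ↔ ∃ n, 1 ≤ n ∧ IsFullAt α n x := by
  rw [jumpTime_eq_sInf, Ne, Nat.sInf_eq_zero, not_or, Set.eq_empty_iff_forall_notMem]
  simp

theorem isFullAt_jumpTime {α x : ℝ} (h : jumpTime α x ≠ 0) : IsFullAt α (jumpTime α x) x :=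
  (Nat.sInf_mem (s := {n | 1 ≤ n ∧ IsFullAt α n x}) (jumpTime_ne_zero_iff.1 h)).2

theorem jumpTime_eq_iff {α x : ℝ} {n : ℕ} (hn : n ≠ 0) : jumpTime α x = n ↔
    IsFullAt α n x ∧ ∀ m, 1 ≤ m → m < n → ¬ IsFullAt α m x := by
  constructor
  · rintro rfl
    exact ⟨isFullAt_jumpTime hn, fun m h1 h2 h3 =>
      Nat.notMem_of_lt_sInf (s := {n | 1 ≤ n ∧ IsFullAt α n x}) h2 ⟨h1, h3⟩⟩
  · rintro ⟨h1, h2⟩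
    have h0 : jumpTime α x ≠ 0 := jumpTime_ne_zero_iff.2 ⟨n, by omega, h1⟩
    refine le_antisymm (Nat.sInf_le ⟨by omega, h1⟩) ?_
    by_contra! hlt
    exact h2 _ (by omega) hlt (isFullAt_jumpTime h0)

theorem measurable_jumpTime (α : ℝ) : Measurable (jumpTime α) := by
  refine measurable_to_countable' fun n => ?_
  rcases eq_or_ne n 0 with rfl | hn
  · have : jumpTime α ⁻¹' {0} = ⋂ n : ℕ, ⋂ _ : 1 ≤ n, {x | IsFullAt α n x}ᶜ := by
      ext x
      have := jumpTime_ne_zero_iff (α := α) (x := x)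
      rw [← not_iff_not] at this
      push Not at this
      simpa using this
    rw [this]
    exact MeasurableSet.iInter fun n => MeasurableSet.iInter fun _ =>
      (measurableSet_isFullAt α n).compl
  · have : jumpTime α ⁻¹' {n} = {x | IsFullAt α n x} ∩
        ⋂ m : ℕ, ⋂ _ : 1 ≤ m, ⋂ _ : m < n, {x | IsFullAt α m x}ᶜ := by
      ext x
      simpa using jumpTime_eq_iff (α := α) (x := x) hn
    rw [this]
    exact (measurableSet_isFullAt α n).inter (MeasurableSet.iInter fun m =>
      MeasurableSet.iInter fun _ => MeasurableSet.iInter fun _ =>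
        (measurableSet_isFullAt α m).compl)

theorem measurable_jumpT (α : ℝ) : Measurable (jumpT α) := by
  intro A hA
  have : jumpT α ⁻¹' A = ⋃ n : ℕ, jumpTime α ⁻¹' {n} ∩ (T α)^[n] ⁻¹' A := by
    ext x
    simp [jumpT]
  rw [this]
  exact MeasurableSet.iUnion fun n => (measurable_jumpTime α (measurableSet_singleton n)).inter
    ((measurable_T α).iterate n hA)

theorem volume_preimage_T_eq_zero {α : ℝ} {N : Set ℝ} (hN : volume N = 0) :
    volume (T α ⁻¹' N) = 0 := by
  have hsub : T α ⁻¹' N ⊆ {0} ∪ ⋃ b : ℤ, (fun y : ℝ => 1 / (b + y)) '' (N \ {-(b : ℝ)}) := by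
    intro x hx
    by_cases h0 : x = 0
    · exact Or.inl h0
    · refine Or.inr (mem_iUnion.2 ⟨firstDigit α x, T α x, ⟨hx, ?_⟩, eq_one_div_add.symm⟩)
      rintro (h : T α x = _)
      apply h0
      rw [eq_one_div_add (α := α) (x := x), h]
      simp
  refine measure_mono_null hsub (measure_union_null (by simp) (measure_iUnion_null fun b => ?_))
  refine addHaar_image_eq_zero_of_differentiableOn_of_addHaar_eq_zero volume ?_
    (measure_mono_null sdiff_subset hN)
  intro y hy
  have : (b : ℝ) + y ≠ 0 := fun h => hy.2 (by simp; linarith)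
  refine DifferentiableAt.differentiableWithinAt ?_
  exact (differentiableAt_const _).div (by fun_prop) this

theorem volume_preimage_iterate_T_eq_zero {α : ℝ} {N : Set ℝ} (hN : volume N = 0) (n : ℕ) :
    volume ((T α)^[n] ⁻¹' N) = 0 := by
  induction n with
  | zero => exact hN
  | succ n ih =>
    rw [Function.iterate_succ, preimage_comp]
    exact volume_preimage_T_eq_zero ih

theorem volume_jumpTime_eq_zero {α : ℝ} (hα : α ∈ Icc (1 / 2 : ℝ) 1) :
    volume {x | x ∈ Ico (α - 1) α ∧ ∃ m, jumpTime α ((T α)^[m] x) = 0} = 0 := by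
  have h0 : volume {x | x ∈ Ico (α - 1) α ∧ jumpTime α x = 0} = 0 := by
    refine measure_mono_null (t := {x | x ∈ Ico (α - 1) α ∧ (∀ k, (T α)^[k] x ≠ 0) ∧
      ∀ m, 1 ≤ m → (T α)^[m] '' cylinderAt α m x ≠ Ico (α - 1) α} ∪
      ⋃ k : ℕ, (T α)^[k] ⁻¹' {0}) ?_ (measure_union_null (volume_nonfull_eq_zero hα)
        (measure_iUnion_null fun k => volume_preimage_iterate_T_eq_zero (by simp) k))
    rintro x ⟨hxI, hx⟩
    by_cases h : ∃ k, (T α)^[k] x = 0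
    · right; simpa using h
    · push Not at h
      refine Or.inl ⟨hxI, h, fun m hm hf => ?_⟩
      exact jumpTime_ne_zero_iff.2 ⟨m, hm, hf⟩ hx
  refine measure_mono_null (t := ⋃ m : ℕ, (T α)^[m] ⁻¹' {x | x ∈ Ico (α - 1) α ∧ jumpTime α x = 0})
    ?_ (measure_iUnion_null fun m => volume_preimage_iterate_T_eq_zero h0 m)
  rintro x ⟨hxI, m, hm⟩
  exact mem_iUnion.2 ⟨m, iterate_T_mem hα hxI m, hm⟩

/-- The `k`-th iterate of the jump transformation is a branch of `T α` on suitable full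
cylinders. -/
theorem exists_full_branch_jumpT {α : ℝ} (hα : α ∈ Icc (1 / 2 : ℝ) 1) (k : ℕ) : ∀ {x : ℝ},
    x ∈ Ico (α - 1) α → (∀ m, jumpTime α ((T α)^[m] x) ≠ 0) → ∃ n, IsFullAt α n x ∧
      ∀ y ∈ cylinderAt α n x, (jumpT α)^[k] y = (T α)^[n] y := by
  induction k with
  | zero =>
    intro x hx _
    refine ⟨0, ?_, fun _ _ => rfl⟩
    rw [IsFullAt, Function.iterate_zero, image_id]
    ext y
    simp [mem_cylinderAt_iff]
  | succ k ih =>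
    intro x hx hN
    have hn1 : jumpTime α x ≠ 0 := hN 0
    obtain ⟨n, hn⟩ : ∃ n, jumpTime α x = n := ⟨_, rfl⟩
    rw [hn] at hn1
    obtain ⟨hfull, hnot⟩ := (jumpTime_eq_iff hn1).1 hn
    obtain ⟨l, hl, hJ⟩ := ih (iterate_T_mem hα hx n) (fun m => by
      rw [← Function.iterate_add_apply]; exact hN _)
    have hmem : ∀ y, y ∈ cylinderAt α (n + l) x ↔
        y ∈ cylinderAt α n x ∧ (T α)^[n] y ∈ cylinderAt α l ((T α)^[n] x) := by
      intro y
      simp only [mem_cylinderAt_iff]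
      constructor
      · rintro ⟨hy, h⟩
        refine ⟨⟨hy, fun k hk => h k (by omega)⟩, iterate_T_mem hα hy n, fun k hk => ?_⟩
        rw [← Function.iterate_add_apply, ← Function.iterate_add_apply]
        exact h _ (by omega)
      · rintro ⟨⟨hy, h⟩, -, h'⟩
        refine ⟨hy, fun k hk => ?_⟩
        rcases Nat.lt_or_ge k n with hkn | hkn
        · exact h k hkn
        · obtain ⟨j, rfl⟩ := Nat.exists_eq_add_of_le' hkn
          rw [Function.iterate_add_apply, Function.iterate_add_apply]
          exact h' j (by omega)
    have hjump : ∀ y ∈ cylinderAt α n x, jumpT α y = (T α)^[n] y := by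
      intro y hy
      have : jumpTime α y = n := by
        rw [jumpTime_eq_iff hn1]
        refine ⟨?_, fun m h1 h2 => ?_⟩
        · rw [IsFullAt, cylinderAt_eq_of_mem hy le_rfl]; exact hfull
        · rw [IsFullAt, cylinderAt_eq_of_mem hy h2.le]; exact hnot m h1 h2
      rw [jumpT, this]
    refine ⟨n + l, ?_, ?_⟩
    · rw [IsFullAt] at hfull hl ⊢
      rw [← hl]
      ext z
      constructor
      · rintro ⟨y, hy, rfl⟩
        exact ⟨(T α)^[n] y, ((hmem y).1 hy).2, by
          rw [← Function.iterate_add_apply, add_comm]⟩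
      · rintro ⟨w, hw, rfl⟩
        have hwI : w ∈ Ico (α - 1) α := hw.1
        rw [← hfull] at hwI
        obtain ⟨y, hy, rfl⟩ := hwI
        exact ⟨y, (hmem y).2 ⟨hy, hw⟩, by rw [← Function.iterate_add_apply, add_comm]⟩
    · intro y hy
      obtain ⟨h1, h2⟩ := (hmem y).1 hy
      rw [Function.iterate_succ_apply, hjump y h1, hJ _ h2, ← Function.iterate_add_apply, add_comm]

theorem iterate_T_ne_zero_of_isFullAt {α : ℝ} (hα : α ∈ Icc (1 / 2 : ℝ) 1) {n : ℕ} {x : ℝ}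
    (h : IsFullAt α n x) : ∀ k < n, (T α)^[k] x ≠ 0 := by
  intro k hk h0
  have hT0 : ∀ j, (T α)^[j] 0 = 0 := fun j => Function.iterate_fixed (by simp [T]) j
  have himage : ∀ z ∈ Ico (α - 1) α, z = 0 := by
    intro z hz
    rw [← h] at hz
    obtain ⟨y, hy, rfl⟩ := hz
    obtain ⟨hyI, hy⟩ := mem_cylinderAt_iff.1 hy
    have h1 := hy k hk
    rw [h0, (firstDigit_eq_zero_iff hα ⟨by linarith [hα.2], by linarith [hα.1]⟩).2 rfl,
      firstDigit_eq_zero_iff hα (iterate_T_mem hα hyI k)] at h1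
    obtain ⟨j, rfl⟩ := Nat.exists_eq_add_of_le' hk.le
    rw [Function.iterate_add_apply, h1, hT0]
  have h1 := himage (α - 1) ⟨le_rfl, by linarith⟩
  have h2 := himage (α - 1 / 2) ⟨by linarith, by linarith⟩
  linarith

theorem volume_cylinder_bounds {α : ℝ} (hα : α ∈ Icc (1 / 2 : ℝ) 1) {n : ℕ} {x : ℝ}
    (hx : x ∈ Ico (α - 1) α) (h : IsFullAt α n x) (A : Set ℝ) :
    volume (cylinderAt α n x ∩ (T α)^[n] ⁻¹' A) ≤
      ENNReal.ofReal (Real.exp 16) * volume (Ico (α - 1) α ∩ A) * volume (cylinderAt α n x) ∧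
    volume (Ico (α - 1) α ∩ A) * volume (cylinderAt α n x) ≤
      ENNReal.ofReal (Real.exp 16) * volume (cylinderAt α n x ∩ (T α)^[n] ⁻¹' A) := by
  set E := cylinderAt α n x
  have hne : ∀ y ∈ E, ∀ k < n, (T α)^[k] y ≠ 0 := fun y hy =>
    iterate_T_ne_zero_of_isFullAt hα
      (by rw [IsFullAt, cylinderAt_eq_of_mem hy le_rfl]; exact h)
  have hxE : x ∈ E := self_mem_cylinderAt hx
  set p := ∏ k ∈ Finset.range n, |(T α)^[k] x| with hp
  have hp0 : 0 < p := Finset.prod_pos fun k hk => abs_pos.2 (hne x hxE k (Finset.mem_range.1 hk))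
  set C := Real.exp 4 with hC
  have hC0 : 0 < C := Real.exp_pos 4
  have hC4 : Real.exp 16 = C * C * (C * C) := by
    rw [hC, ← Real.exp_add, ← Real.exp_add]; norm_num
  have hup : ∀ y ∈ E, ∏ k ∈ Finset.range n, |(T α)^[k] y| ≤ C * p := fun y hy =>
    prod_abs_le hα (mem_cylinderAt_iff.1 hy).1 hx (hne y hy) (hne x hxE)
      (mem_cylinderAt_iff.1 hy).2
  have hlo : ∀ y ∈ E, p ≤ C * ∏ k ∈ Finset.range n, |(T α)^[k] y| := fun y hy =>
    prod_abs_le hα hx (mem_cylinderAt_iff.1 hy).1 (hne x hxE) (hne y hy)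
      (fun k hk => ((mem_cylinderAt_iff.1 hy).2 k hk).symm)
  have hnn : ∀ y : ℝ, 0 ≤ ∏ k ∈ Finset.range n, |(T α)^[k] y| := fun y =>
    Finset.prod_nonneg fun _ _ => abs_nonneg _
  have hdist : ∀ y ∈ E, ∀ z ∈ E, |y - z| = (∏ k ∈ Finset.range n, |(T α)^[k] y|) *
      (∏ k ∈ Finset.range n, |(T α)^[k] z|) * |(T α)^[n] y - (T α)^[n] z| := fun y hy z hz =>
    abs_sub_eq_prod (hne y hy) (hne z hz) fun k hk =>
      ((mem_cylinderAt_iff.1 hy).2 k hk).trans ((mem_cylinderAt_iff.1 hz).2 k hk).symm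
  have hA : ∀ B ⊆ E, volume B ≤ ENNReal.ofReal (C * C * (p * p)) * volume ((T α)^[n] '' B) := by
    intro B hB
    refine volume_le_image_of_dist_le (by positivity) fun y hy z hz => ?_
    rw [hdist y (hB hy) z (hB hz)]
    refine mul_le_mul_of_nonneg_right ?_ (abs_nonneg _)
    calc _ ≤ (C * p) * (C * p) := mul_le_mul (hup y (hB hy)) (hup z (hB hz)) (hnn z) (by positivity)
      _ = _ := by ring
  have hB : ∀ B ⊆ E, volume ((T α)^[n] '' B) ≤ ENNReal.ofReal (C * C / (p * p)) * volume B := by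
    intro B hB
    refine volume_image_le_of_dist_le (by positivity) fun y hy z hz => ?_
    rw [hdist y (hB hy) z (hB hz), div_mul_eq_mul_div, le_div_iff₀ (by positivity)]
    have := mul_le_mul (hlo y (hB hy)) (hlo z (hB hz)) hp0.le (mul_nonneg hC0.le (hnn y))
    have := mul_le_mul_of_nonneg_right this (abs_nonneg ((T α)^[n] y - (T α)^[n] z))
    nlinarith
  have himage : (T α)^[n] '' (E ∩ (T α)^[n] ⁻¹' A) = Ico (α - 1) α ∩ A := by
    rw [image_inter_preimage]; rw [IsFullAt] at h; rw [h]
  have hI : volume (Ico (α - 1) α) = 1 := by rw [Real.volume_Ico]; simp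
  have hE1 := hA E le_rfl
  have hE2 := hB E le_rfl
  rw [show (T α)^[n] '' E = Ico (α - 1) α from h, hI] at hE1 hE2
  have hB1 := hA _ (inter_subset_left (s := E) (t := (T α)^[n] ⁻¹' A))
  have hB2 := hB _ (inter_subset_left (s := E) (t := (T α)^[n] ⁻¹' A))
  rw [himage] at hB1 hB2
  have hmul : ENNReal.ofReal (C * C * (p * p)) * ENNReal.ofReal (C * C / (p * p))
      = ENNReal.ofReal (Real.exp 16) := by
    rw [← ENNReal.ofReal_mul (by positivity), hC4]
    congr 1
    field_simp
  rw [← hmul]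
  constructor
  · calc _ ≤ ENNReal.ofReal (C * C * (p * p)) * volume (Ico (α - 1) α ∩ A) * 1 := by
          rwa [mul_one]
      _ ≤ ENNReal.ofReal (C * C * (p * p)) * volume (Ico (α - 1) α ∩ A) *
          (ENNReal.ofReal (C * C / (p * p)) * volume E) := by gcongr
      _ = _ := by ring
  · calc _ ≤ (ENNReal.ofReal (C * C / (p * p)) * volume (E ∩ (T α)^[n] ⁻¹' A)) *
          (ENNReal.ofReal (C * C * (p * p)) * 1) := by gcongr
      _ = _ := by ring

/-- Countably many disjoint full cylinders on which the `k`-th iterate of the jump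
transformation is a branch of `T α` exhaust the interval up to a null set. -/
theorem exists_full_branch_partition {α : ℝ} (hα : α ∈ Icc (1 / 2 : ℝ) 1) (k : ℕ) :
    ∃ 𝒮 : Set (Set ℝ), 𝒮.Countable ∧ 𝒮.PairwiseDisjoint id ∧
      (∀ S ∈ 𝒮, ∃ n, ∃ x ∈ Ico (α - 1) α, S = cylinderAt α n x ∧ IsFullAt α n x ∧
        ∀ y ∈ S, (jumpT α)^[k] y = (T α)^[n] y) ∧
      (⋃ S ∈ 𝒮, S) =ᵐ[volume] Ico (α - 1) α := by
  let P : ℕ → ℝ → Prop := fun n x =>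
    IsFullAt α n x ∧ ∀ y ∈ cylinderAt α n x, (jumpT α)^[k] y = (T α)^[n] y
  let W : Set ℝ := {x | x ∈ Ico (α - 1) α ∧ ∃ n, P n x}
  let ord : ℝ → ℕ := fun x => sInf {n | P n x}
  let E : ℝ → Set ℝ := fun x => cylinderAt α (ord x) x
  have hcongr : ∀ {x y n m}, y ∈ cylinderAt α n x → m ≤ n → (P m y ↔ P m x) := by
    intro x y n m hy hm
    simp only [P, IsFullAt, cylinderAt_eq_of_mem hy hm]
  have hP : ∀ x ∈ W, P (ord x) x := fun x hx => Nat.sInf_mem (s := {n | P n x}) hx.2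
  have hEeq : ∀ x ∈ W, ∀ y ∈ E x, y ∈ W ∧ E y = E x := by
    intro x hx y hy
    have hPy : P (ord x) y := (hcongr hy le_rfl).2 (hP x hx)
    have hyW : y ∈ W := ⟨(mem_cylinderAt_iff.1 hy).1, _, hPy⟩
    have hle : ord y ≤ ord x := Nat.sInf_le hPy
    have hge : ord x ≤ ord y := Nat.sInf_le ((hcongr hy hle).1 (hP y hyW))
    refine ⟨hyW, ?_⟩
    simp only [E]
    rw [le_antisymm hle hge, cylinderAt_eq_of_mem hy le_rfl]
  refine ⟨E '' W, ?_, ?_, ?_, ?_⟩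
  · refine (countable_range_cylinderAt α).mono ?_
    rintro _ ⟨x, _, rfl⟩
    exact ⟨(ord x, x), rfl⟩
  · rintro _ ⟨x, hx, rfl⟩ _ ⟨y, hy, rfl⟩ hne
    refine Set.disjoint_left.2 fun z hz hz' => hne ?_
    rw [← (hEeq x hx z hz).2, (hEeq y hy z hz').2]
  · rintro _ ⟨x, hx, rfl⟩
    exact ⟨ord x, x, hx.1, rfl, (hP x hx).1, (hP x hx).2⟩
  · have hU : (⋃ S ∈ E '' W, S) = W := by
      ext z
      simp only [mem_iUnion, exists_prop, mem_image, exists_exists_and_eq_and]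
      constructor
      · rintro ⟨x, hx, hz⟩
        exact (hEeq x hx z hz).1
      · exact fun hz => ⟨z, hz, self_mem_cylinderAt hz.1⟩
    rw [hU]
    refine Filter.EventuallyLE.antisymm (LE.le.eventuallyLE fun x hx => hx.1) ?_
    have h0 := volume_jumpTime_eq_zero hα
    filter_upwards [measure_eq_zero_iff_ae_notMem.1 h0] with x hx hxI
    refine ⟨hxI, ?_⟩
    refine exists_full_branch_jumpT hα k hxI fun m hm => hx ⟨hxI, m, hm⟩

theorem volume_preimage_jumpT_bounds {α : ℝ} (hα : α ∈ Icc (1 / 2 : ℝ) 1) (k : ℕ) {A : Set ℝ}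
    (hA : MeasurableSet A) :
    volume.restrict (Ico (α - 1) α) ((jumpT α)^[k] ⁻¹' A) ≤
      ENNReal.ofReal (Real.exp 16) * volume.restrict (Ico (α - 1) α) A ∧
    volume.restrict (Ico (α - 1) α) A ≤
      ENNReal.ofReal (Real.exp 16) * volume.restrict (Ico (α - 1) α) ((jumpT α)^[k] ⁻¹' A) := by
  obtain ⟨𝒮, hcount, hdisj, hS, hae⟩ := exists_full_branch_partition hα k
  have hmS : ∀ S ∈ 𝒮, MeasurableSet S := by
    intro S hS'
    obtain ⟨n, x, -, rfl, -⟩ := hS S hS'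
    exact measurableSet_cylinderAt α n x
  have hJA : MeasurableSet ((jumpT α)^[k] ⁻¹' A) := (measurable_jumpT α).iterate k hA
  have hone : ∑' S : 𝒮, volume (S : Set ℝ) = 1 := by
    have h1 := measure_biUnion (μ := volume) hcount hdisj hmS
    simp only [id] at h1
    rw [← h1, measure_congr hae, Real.volume_Ico]
    simp
  have hsum : volume.restrict (Ico (α - 1) α) ((jumpT α)^[k] ⁻¹' A)
      = ∑' S : 𝒮, volume ((S : Set ℝ) ∩ (jumpT α)^[k] ⁻¹' A) := by
    rw [Measure.restrict_apply hJA, ← measure_biUnion hcount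
      (f := fun S => S ∩ (jumpT α)^[k] ⁻¹' A)
      (hdisj.mono_on fun S _ => inter_subset_left) fun S h => (hmS S h).inter hJA,
      ← iUnion₂_inter, inter_comm]
    exact (measure_congr (hae.inter (Filter.EventuallyEq.refl _ _))).symm
  have hbd : ∀ S : 𝒮, volume ((S : Set ℝ) ∩ (jumpT α)^[k] ⁻¹' A) ≤
      ENNReal.ofReal (Real.exp 16) * volume (Ico (α - 1) α ∩ A) * volume (S : Set ℝ) ∧
      volume (Ico (α - 1) α ∩ A) * volume (S : Set ℝ) ≤
      ENNReal.ofReal (Real.exp 16) * volume ((S : Set ℝ) ∩ (jumpT α)^[k] ⁻¹' A) := by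
    rintro ⟨S, hS'⟩
    obtain ⟨n, x, hx, rfl, hf, hJ⟩ := hS S hS'
    have he : cylinderAt α n x ∩ (jumpT α)^[k] ⁻¹' A = cylinderAt α n x ∩ (T α)^[n] ⁻¹' A := by
      ext y
      refine and_congr_right fun hy => ?_
      rw [mem_preimage, mem_preimage, hJ y hy]
    simp only [he]
    exact volume_cylinder_bounds hα hx hf A
  rw [hsum, Measure.restrict_apply hA, inter_comm A]
  constructor
  · calc _ ≤ ∑' S : 𝒮, ENNReal.ofReal (Real.exp 16) * volume (Ico (α - 1) α ∩ A) *
          volume (S : Set ℝ) := ENNReal.tsum_le_tsum fun S => (hbd S).1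
      _ = _ := by rw [ENNReal.tsum_mul_left, hone, mul_one]
  · calc volume (Ico (α - 1) α ∩ A)
        = ∑' S : 𝒮, volume (Ico (α - 1) α ∩ A) * volume (S : Set ℝ) := by
          rw [ENNReal.tsum_mul_left, hone, mul_one]
      _ ≤ ∑' S : 𝒮, ENNReal.ofReal (Real.exp 16) *
          volume ((S : Set ℝ) ∩ (jumpT α)^[k] ⁻¹' A) := ENNReal.tsum_le_tsum fun S => (hbd S).2
      _ = _ := ENNReal.tsum_mul_left

/-- There exists a Borel probability measure on [α−1, α) equivalent to Lebesgue
measure and invariant under the jump transformation T̊_α. -/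
theorem exists_jump_invariant_measure (α : ℝ) (hα : α ∈ Set.Icc (1 / 2 : ℝ) 1) :
    ∃ ν : Measure ℝ, IsProbabilityMeasure ν ∧
      ν ≪ volume.restrict (Set.Ico (α - 1) α) ∧
      volume.restrict (Set.Ico (α - 1) α) ≪ ν ∧
      MeasurePreserving (jumpT α) ν ν := by
  have : IsProbabilityMeasure (volume.restrict (Set.Ico (α - 1) α)) :=
    ⟨by rw [Measure.restrict_apply_univ, Real.volume_Ico]; simp⟩
  exact exists_invariant_measure_of_uniform_bounds _ (measurable_jumpT α)
    ENNReal.ofReal_ne_top (fun k _ hA => (volume_preimage_jumpT_bounds hα k hA).1)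
    (fun k _ hA => (volume_preimage_jumpT_bounds hα k hA).2)
end
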